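/- Let the intervals of all derived graph orders 1 through n−1 be given, with interval I^j(h^j_i) having edge set E_{I^j(h^j_i)}. If no interval at any order has multiple exit edges to the same external node, then the total number of interval-internal edges summed over all orders, ∑_{j=1}^{n-1} ∑_i |E_{I^j(h^j_i)}|, is at most |E|, the number of edges of the original first-order graph. -/

import Mathlib

/-- Edges of a finite graph split into the edges internal to a fibre of `q` and those crossing
between fibres; the latter surject onto the loop-free quotient edges. -/
theorem sum_ncard_internal_add_ncard_quotient_le {V : Type*} [Fintype V]
    (R S : V → V → Prop) (q : V → V)
    (hS : ∀ a b, S a b → a ≠ b ∧ ∃ u v, q u = a ∧ q v = b ∧ R u v) :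
    (∑ h : V, Set.ncard {e : V × V | R e.1 e.2 ∧ q e.1 = h ∧ q e.2 = h}) +
        Set.ncard {e : V × V | S e.1 e.2} ≤
      Set.ncard {e : V × V | R e.1 e.2} := by
  classical
  have hint : ∑ h : V, Set.ncard {e : V × V | R e.1 e.2 ∧ q e.1 = h ∧ q e.2 = h} =
      Set.ncard {e : V × V | R e.1 e.2 ∧ q e.1 = q e.2} := by
    simp only [Set.ncard_eq_toFinset_card', Set.toFinset_ofPred]
    rw [Finset.card_eq_sum_card_fiberwise (f := fun e : V × V => q e.1) (t := Finset.univ)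
      (fun _ _ => by simp)]
    refine Finset.sum_congr rfl fun h _ => congrArg Finset.card ?_
    ext e
    simp only [Finset.mem_filter, Finset.mem_univ, true_and]
    grind
  have hquot : Set.ncard {e : V × V | S e.1 e.2} ≤
      Set.ncard {e : V × V | R e.1 e.2 ∧ q e.1 ≠ q e.2} := by
    refine (Set.ncard_le_ncard (t := Prod.map q q '' {e | R e.1 e.2 ∧ q e.1 ≠ q e.2}) ?_
      (Set.toFinite _)).trans (Set.ncard_image_le (Set.toFinite _))
    rintro ⟨a, b⟩ hab
    obtain ⟨hne, u, v, rfl, rfl, huv⟩ := hS a b hab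
    exact ⟨(u, v), ⟨huv, hne⟩, rfl⟩
  have hdisj : Disjoint {e : V × V | R e.1 e.2 ∧ q e.1 = q e.2}
      {e : V × V | R e.1 e.2 ∧ q e.1 ≠ q e.2} :=
    Set.disjoint_left.mpr fun _ h h' => h'.2 h.2
  calc _ ≤ _ := Nat.add_le_add hint.le hquot
    _ = _ := (Set.ncard_union_eq hdisj (Set.toFinite _) (Set.toFinite _)).symm
    _ ≤ _ := Set.ncard_le_ncard (Set.union_subset (fun _ h => h.1) fun _ h => h.1)
      (Set.toFinite _)


/-- in a hierarchy of derived interval graphs `E 1, ..., E n` with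
interval (header) maps `p j`, if no interval at any order has multiple exit edges to
the same external node, then the total number of interval-internal edges summed over
orders 1 through n−1 is at most the number of edges of the original graph.

`p j v` is the header of the interval containing `v` in the order-`j` graph `E j`
(so headers are the fixed points of `p j`), the order-`(j+1)` graph is obtained by
collapsing each interval to its header and each interval-exit edge to an edge, and
the internal edges of interval `h` at order `j` are the edges of `E j` with both
endpoints in the interval of `h`. -/
theorem stmt9 {V : Type*} [Fintype V] (n : ℕ)
    (E : ℕ → V → V → Prop) (p : ℕ → V → V)
    (hidem : ∀ j v, p j (p j v) = p j v)
    (hder : ∀ j a b, E (j + 1) a b ↔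
      (a ≠ b ∧ ∃ u v, p j u = a ∧ p j v = b ∧ E j u v))
    (hexit : ∀ j ∈ Finset.Icc 1 (n - 1), ∀ h v : V, p j v ≠ h →
      {u : V | p j u = h ∧ E j u v}.Subsingleton) :
    (∑ j ∈ Finset.Icc 1 (n - 1), ∑ h : V,
        Set.ncard {e : V × V | E j e.1 e.2 ∧ p j e.1 = h ∧ p j e.2 = h}) ≤
      Set.ncard {e : V × V | E 1 e.1 e.2} := by
  have key : ∀ m : ℕ, (∑ j ∈ Finset.Icc 1 m, ∑ h : V,
        Set.ncard {e : V × V | E j e.1 e.2 ∧ p j e.1 = h ∧ p j e.2 = h}) +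
        Set.ncard {e : V × V | E (m + 1) e.1 e.2} ≤
      Set.ncard {e : V × V | E 1 e.1 e.2} := by
    intro m
    induction m with
    | zero => simp
    | succ m ih =>
      rw [Finset.sum_Icc_succ_top (by omega)]
      have := sum_ncard_internal_add_ncard_quotient_le (E (m + 1)) (E (m + 1 + 1)) (p (m + 1))
        fun a b => (hder (m + 1) a b).mp
      omega
  exact (Nat.le_add_right _ _).trans (key (n - 1))
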